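/- Suppose in addition that ν_1 and ν_2 have finite means τ_1 = ∫ x dν_1(x) and τ_2 = ∫ x dν_2(x). Let p_0 ∈ ℝ and let ψ : (0,∞) → ℝ satisfy |ψ(s)| ≤ 1 for all s > 0, the functional equation ψ(s) = p_0 + ψ(s+θ1)·H_1(s) + ψ(s+θ2)·H_2(s) for all s > 0, and the normalization p_0 = 1 − λ1·τ_1·ψ(θ1) − λ2·τ_2·ψ(θ2). Then, writing c(s) = Σ_{i≥0} Σ_{j≥0} c_{i,j}(s), one has p_0 = [ 1 + λ1·τ_1·c(θ1) + λ2·τ_2·c(θ2) ]^{−1}. -/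

import Mathlib

open MeasureTheory
open scoped ENNReal

/-- The Laplace–Stieltjes transform `G̃(s) = ∫ e^{-sx} dν(x)`. -/
noncomputable def Gtil (ν : Measure ℝ) (s : ℝ) : ℝ := ∫ x, Real.exp (-s * x) ∂ν

/-- `H(s) = λ(1 - G̃(s))/s`. -/
noncomputable def Hfun (l : ℝ) (ν : Measure ℝ) (s : ℝ) : ℝ := l * (1 - Gtil ν s) / s

lemma Hfun_bounds (l : ℝ) (hl : 0 < l) (ν : Measure ℝ) [IsProbabilityMeasure ν]
    (hν : ν (Set.Iio 0) = 0) (s : ℝ) (hs : 0 < s) :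
    0 ≤ Hfun l ν s ∧ Hfun l ν s ≤ l / s := by
  have h0 : 0 ≤ Gtil ν s := integral_nonneg fun x => (Real.exp_pos _).le
  have hae : ∀ᵐ x ∂ν, 0 ≤ x := by
    rw [ae_iff]
    convert hν using 2
    ext x
    simp
  have h1 : Gtil ν s ≤ 1 := by
    have h : ‖∫ x, Real.exp (-s * x) ∂ν‖ ≤ 1 * ν.real Set.univ := by
      apply norm_integral_le_of_norm_le_const
      filter_upwards [hae] with x hx
      rw [Real.norm_eq_abs, abs_of_pos (Real.exp_pos _), Real.exp_le_one_iff]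
      nlinarith
    rw [probReal_univ, mul_one] at h
    exact (le_abs_self _).trans h
  unfold Hfun
  constructor
  · apply div_nonneg (mul_nonneg hl.le (by linarith)) hs.le
  · apply div_le_div_of_nonneg_right _ hs.le
    nlinarith

lemma psi_formula
    (l1 l2 t1 t2 : ℝ) (hl1 : 0 < l1) (hl2 : 0 < l2) (ht1 : 0 < t1) (ht2 : 0 < t2)
    (ν1 ν2 : Measure ℝ) [IsProbabilityMeasure ν1] [IsProbabilityMeasure ν2]
    (hν1 : ν1 (Set.Iio 0) = 0) (hν2 : ν2 (Set.Iio 0) = 0)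
    (c : ℤ → ℤ → ℝ → ℝ)
    (hc00 : ∀ s : ℝ, c 0 0 s = 1)
    (hcneg : ∀ (i j : ℤ) (s : ℝ), i < 0 ∨ j < 0 → c i j s = 0)
    (hcrec : ∀ (i j : ℤ), 0 ≤ i → 0 ≤ j → 0 < i + j → ∀ s : ℝ,
      c i j s =
        Hfun l1 ν1 (s + ((i : ℝ) - 1) * t1 + (j : ℝ) * t2) * c (i - 1) j s
          + Hfun l2 ν2 (s + (i : ℝ) * t1 + ((j : ℝ) - 1) * t2) * c i (j - 1) s)
    (p0 : ℝ) (ψ : ℝ → ℝ)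
    (hbd : ∀ s : ℝ, 0 < s → |ψ s| ≤ 1)
    (heq : ∀ s : ℝ, 0 < s →
      ψ s = p0 + ψ (s + t1) * Hfun l1 ν1 s + ψ (s + t2) * Hfun l2 ν2 s)
    (s : ℝ) (hs : 0 < s) :
    ψ s = p0 * ∑' q : ℕ × ℕ, c (q.1 : ℤ) (q.2 : ℤ) s := by
  set u : ℕ × ℕ → ℝ := fun p => s + p.1 * t1 + p.2 * t2 with hu
  have hupos : ∀ p, 0 < u p := fun p => by simp only [hu]; positivity
  set d : ℕ × ℕ → ℝ := fun p => c (p.1 : ℤ) (p.2 : ℤ) s with hd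
  set S : ℕ → ℝ := fun n => ∑ p ∈ Finset.HasAntidiagonal.antidiagonal n, d p with hS
  have key : ∀ (n : ℕ) (f : ℝ → ℝ),
      ∑ p ∈ Finset.HasAntidiagonal.antidiagonal (n + 1), d p * f (u p)
        = ∑ p ∈ Finset.HasAntidiagonal.antidiagonal n,
          d p * (Hfun l1 ν1 (u p) * f (u p + t1) + Hfun l2 ν2 (u p) * f (u p + t2)) := by
    intro n f
    have e1 : ∑ p ∈ Finset.HasAntidiagonal.antidiagonal (n + 1), d p * f (u p)
        = ∑ p ∈ Finset.HasAntidiagonal.antidiagonal (n + 1),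
            Hfun l1 ν1 (s + ((p.1 : ℝ) - 1) * t1 + (p.2 : ℝ) * t2)
              * c ((p.1 : ℤ) - 1) p.2 s * f (u p)
          + ∑ p ∈ Finset.HasAntidiagonal.antidiagonal (n + 1),
            Hfun l2 ν2 (s + (p.1 : ℝ) * t1 + ((p.2 : ℝ) - 1) * t2)
              * c (p.1 : ℤ) ((p.2 : ℤ) - 1) s * f (u p) := by
      rw [← Finset.sum_add_distrib]
      apply Finset.sum_congr rfl
      intro p hp
      rw [Finset.HasAntidiagonal.mem_antidiagonal] at hp
      have := hcrec p.1 p.2 (by positivity) (by positivity) (by omega) s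
      simp only [hd]
      rw [this]
      push_cast
      ring
    rw [e1, Finset.Nat.sum_antidiagonal_succ, Finset.Nat.sum_antidiagonal_succ']
    rw [hcneg _ _ s (Or.inl (by simp)), hcneg _ (_ - 1) s (Or.inr (by simp))]
    simp only [mul_zero, zero_mul, zero_add, add_zero]
    rw [← Finset.sum_add_distrib]
    apply Finset.sum_congr rfl
    intro p _
    have a1 : u (p.1 + 1, p.2) = u p + t1 := by simp only [hu]; push_cast; ring
    have a2 : u (p.1, p.2 + 1) = u p + t2 := by simp only [hu]; push_cast; ring
    rw [a1, a2]
    push_cast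
    simp only [add_sub_cancel_right, hd, hu]
    ring
  have H1 := fun p => Hfun_bounds l1 hl1 ν1 hν1 (u p) (hupos p)
  have H2 := fun p => Hfun_bounds l2 hl2 ν2 hν2 (u p) (hupos p)
  have dnn : ∀ n : ℕ, ∀ i j : ℕ, i + j = n → 0 ≤ c (i : ℤ) (j : ℤ) s := by
    intro n
    induction n with
    | zero =>
      intro i j h
      obtain ⟨rfl, rfl⟩ : i = 0 ∧ j = 0 := by omega
      simp [hc00]
    | succ n ih =>
      intro i j h
      rw [hcrec i j (by positivity) (by positivity) (by omega) s]
      apply add_nonneg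
      · rcases i with _ | i
        · rw [hcneg _ _ s (Or.inl (by simp)), mul_zero]
        · have h1 := (H1 (i, j)).1
          have h2 := ih i j (by omega)
          simp only [hu] at h1
          push_cast
          simp only [add_sub_cancel_right]
          exact mul_nonneg h1 h2
      · rcases j with _ | j
        · rw [hcneg _ (_ - 1) s (Or.inr (by simp)), mul_zero]
        · have h1 := (H2 (i, j)).1
          have h2 := ih i j (by omega)
          simp only [hu] at h1
          push_cast
          simp only [add_sub_cancel_right]
          exact mul_nonneg h1 h2
  have dnn' : ∀ p, 0 ≤ d p := fun p => dnn _ p.1 p.2 rfl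
  have Snn : ∀ n, 0 ≤ S n := fun n => Finset.sum_nonneg fun p _ => dnn' p
  set m := min t1 t2 with hm
  have hmpos : 0 < m := lt_min ht1 ht2
  have ratio : ∀ n : ℕ, S (n + 1) ≤ (l1 + l2) / (s + n * m) * S n := by
    intro n
    have k := key n (fun _ => 1)
    simp only [mul_one] at k
    simp only [hS]
    rw [k, Finset.mul_sum]
    apply Finset.sum_le_sum
    intro p hp
    rw [Finset.HasAntidiagonal.mem_antidiagonal] at hp
    rw [mul_comm]
    apply mul_le_mul_of_nonneg_right _ (dnn' p)
    have hle : s + n * m ≤ u p := by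
      simp only [hu]
      rw [← hp]
      push_cast
      have b1 : (p.1 : ℝ) * m ≤ p.1 * t1 :=
        mul_le_mul_of_nonneg_left (min_le_left _ _) (by positivity)
      have b2 : (p.2 : ℝ) * m ≤ p.2 * t2 :=
        mul_le_mul_of_nonneg_left (min_le_right _ _) (by positivity)
      linarith
    have hpos : 0 < s + n * m := by positivity
    calc _ ≤ l1 / u p + l2 / u p := add_le_add (H1 p).2 (H2 p).2
      _ = (l1 + l2) / u p := by ring
      _ ≤ _ := by gcongr
  have Ssum : Summable S := by
    apply summable_of_ratio_norm_eventually_le (r := 1 / 2) (by norm_num)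
    obtain ⟨N, hN⟩ := exists_nat_ge (2 * (l1 + l2) / m)
    filter_upwards [Filter.eventually_ge_atTop N] with n hn
    rw [Real.norm_of_nonneg (Snn _), Real.norm_of_nonneg (Snn _)]
    refine (ratio n).trans (mul_le_mul_of_nonneg_right ?_ (Snn n))
    have hnN : (N : ℝ) ≤ n := by exact_mod_cast hn
    rw [div_le_iff₀ hmpos] at hN
    rw [div_le_iff₀ (by positivity)]
    nlinarith
  have dS : ∑' p, d p = ∑' n, S n := by
    have hsig : Summable (fun x : (Σ n : ℕ, Finset.HasAntidiagonal.antidiagonal n) =>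
        d (Finset.HasAntidiagonal.sigmaAntidiagonalEquivProd x)) := by
      rw [summable_sigma_of_nonneg (fun x => dnn' _)]
      refine ⟨fun n => Summable.of_finite, ?_⟩
      convert Ssum using 2 with n
      rw [tsum_fintype]
      exact Finset.sum_coe_sort (Finset.HasAntidiagonal.antidiagonal n) d
    rw [← Finset.HasAntidiagonal.sigmaAntidiagonalEquivProd.tsum_eq d]
    rw [Summable.tsum_sigma' (fun n => Summable.of_finite) hsig]
    congr 1
    ext n
    rw [tsum_fintype]
    exact Finset.sum_coe_sort (Finset.HasAntidiagonal.antidiagonal n) d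
  have iter : ∀ n : ℕ, ψ s = p0 * ∑ k ∈ Finset.range n, S k
      + ∑ p ∈ Finset.HasAntidiagonal.antidiagonal n, d p * ψ (u p) := by
    intro n
    induction n with
    | zero => simp [hd, hu, hc00]
    | succ n ih =>
      rw [ih, key, Finset.sum_range_succ, mul_add, add_assoc]
      congr 1
      simp only [hS]
      rw [Finset.mul_sum, ← Finset.sum_add_distrib]
      apply Finset.sum_congr rfl
      intro p _
      rw [heq (u p) (hupos p)]
      ring
  have rem : Filter.Tendsto (fun n => ∑ p ∈ Finset.HasAntidiagonal.antidiagonal n, d p * ψ (u p))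
      Filter.atTop (nhds 0) := by
    apply squeeze_zero_norm _ Ssum.tendsto_atTop_zero
    intro n
    refine (norm_sum_le _ _).trans (Finset.sum_le_sum fun p _ => ?_)
    rw [norm_mul, Real.norm_of_nonneg (dnn' p)]
    exact mul_le_of_le_one_right (dnn' p) (hbd _ (hupos p))
  have lim := (Ssum.hasSum.tendsto_sum_nat.const_mul p0).add rem
  rw [add_zero] at lim
  have lim2 := lim.congr (fun n => (iter n).symm)
  rw [dS]
  exact tendsto_nhds_unique tendsto_const_nhds lim2

/-- If additionally `ν₁, ν₂` have finite means `τ₁, τ₂` and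
`p₀ = 1 − λ1·τ1·ψ(θ1) − λ2·τ2·ψ(θ2)`, then
`p₀ = [1 + λ1·τ1·c(θ1) + λ2·τ2·c(θ2)]⁻¹`. -/
theorem p0_formula
    (l1 l2 t1 t2 : ℝ) (hl1 : 0 < l1) (hl2 : 0 < l2) (ht1 : 0 < t1) (ht2 : 0 < t2)
    (ν1 ν2 : Measure ℝ) [IsProbabilityMeasure ν1] [IsProbabilityMeasure ν2]
    (hν1 : ν1 (Set.Iio 0) = 0) (hν2 : ν2 (Set.Iio 0) = 0)
    (c : ℤ → ℤ → ℝ → ℝ)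
    (hc00 : ∀ s : ℝ, c 0 0 s = 1)
    (hcneg : ∀ (i j : ℤ) (s : ℝ), i < 0 ∨ j < 0 → c i j s = 0)
    (hcrec : ∀ (i j : ℤ), 0 ≤ i → 0 ≤ j → 0 < i + j → ∀ s : ℝ,
      c i j s =
        Hfun l1 ν1 (s + ((i : ℝ) - 1) * t1 + (j : ℝ) * t2) * c (i - 1) j s
          + Hfun l2 ν2 (s + (i : ℝ) * t1 + ((j : ℝ) - 1) * t2) * c i (j - 1) s)
    (hint1 : Integrable (fun x : ℝ => x) ν1) (hint2 : Integrable (fun x : ℝ => x) ν2)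
    (p0 : ℝ) (ψ : ℝ → ℝ)
    (hbd : ∀ s : ℝ, 0 < s → |ψ s| ≤ 1)
    (heq : ∀ s : ℝ, 0 < s →
      ψ s = p0 + ψ (s + t1) * Hfun l1 ν1 s + ψ (s + t2) * Hfun l2 ν2 s)
    (hnorm : p0 = 1 - l1 * (∫ x : ℝ, x ∂ν1) * ψ t1 - l2 * (∫ x : ℝ, x ∂ν2) * ψ t2) :
    p0 = (1 + l1 * (∫ x : ℝ, x ∂ν1) * (∑' q : ℕ × ℕ, c (q.1 : ℤ) (q.2 : ℤ) t1)
            + l2 * (∫ x : ℝ, x ∂ν2) * (∑' q : ℕ × ℕ, c (q.1 : ℤ) (q.2 : ℤ) t2))⁻¹ := by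
  have e1 := psi_formula l1 l2 t1 t2 hl1 hl2 ht1 ht2 ν1 ν2 hν1 hν2 c hc00 hcneg hcrec p0 ψ hbd heq t1 ht1
  have e2 := psi_formula l1 l2 t1 t2 hl1 hl2 ht1 ht2 ν1 ν2 hν1 hν2 c hc00 hcneg hcrec p0 ψ hbd heq t2 ht2
  rw [e1, e2] at hnorm
  apply eq_inv_of_mul_eq_one_left
  linear_combination hnorm
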